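/- Let [a,b) be a finite interval, p ∈ ℕ₀, and let 𝒦 = (t_i)_{i∈ℤ} be a bi-infinite nondecreasing real knot sequence with t_i → ±∞ as i → ±∞. Let S denote the vector space of all functions f : [a,b) → ℝ that are right-continuous, coincide on each nonempty intersection [t_{i−1}, t_i) ∩ [a,b) with a polynomial of degree at most p, and are p − k times continuously differentiable at every knot t ∈ (a,b) of multiplicity k := #{i : t_i = t} whenever p − k ≥ 0. Then the set of nonzero restrictions { B_{i,p}|_{[a,b)} : i ∈ ℤ, B_{i,p}|_{[a,b)} ≠ 0 } is a basis of S. -/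

import Mathlib

open Set

/-- The coefficient functions of the Cox–de Boor recursion. -/
noncomputable def bsBeta (t : ℤ → ℝ) (i : ℤ) (p : ℕ) (x : ℝ) : ℝ :=
  if t i = t (i + p) then 0 else (x - t i) / (t (i + p) - t i)

/-- B-splines via the Cox–de Boor recursion. -/
noncomputable def Bspline (t : ℤ → ℝ) : ℕ → ℤ → ℝ → ℝ
  | 0, i, x => if x ∈ Set.Ico (t (i - 1)) (t i) then 1 else 0
  | p + 1, i, x => bsBeta t (i - 1) (p + 1) x * Bspline t p i x
      + (1 - bsBeta t i (p + 1) x) * Bspline t p (i + 1) x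


namespace BSplineBasis

open Polynomial

/-- Polynomial form of the Cox–de Boor coefficient functions. -/
noncomputable def betaPoly (t : ℤ → ℝ) (i : ℤ) (p : ℕ) : ℝ[X] :=
  if t i = t (i + p) then 0 else C (t (i + p) - t i)⁻¹ * (X - C (t i))

/-- The polynomial with which `Bspline t p i` coincides on the knot interval `[t (j - 1), t j)`. -/
noncomputable def piece (t : ℤ → ℝ) (j : ℤ) : ℕ → ℤ → ℝ[X]
  | 0, i => if i = j then 1 else 0
  | p + 1, i => betaPoly t (i - 1) (p + 1) * piece t j p i
      + (1 - betaPoly t i (p + 1)) * piece t j p (i + 1)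

/-- The polynomial whose roots are the interior knots of `Bspline t p i`. -/
noncomputable def knotPoly (t : ℤ → ℝ) (p : ℕ) (i : ℤ) : ℝ[X] :=
  ∏ k ∈ Finset.range p, (X - C (t (i + k)))

lemma eval_betaPoly (t : ℤ → ℝ) (i : ℤ) (p : ℕ) (x : ℝ) :
    (betaPoly t i p).eval x = bsBeta t i p x := by
  unfold betaPoly bsBeta
  split_ifs <;> simp [div_eq_inv_mul]

lemma natDegree_betaPoly_le (t : ℤ → ℝ) (i : ℤ) (p : ℕ) : (betaPoly t i p).natDegree ≤ 1 := by
  unfold betaPoly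
  split_ifs
  · simp
  · exact (natDegree_C_mul_le _ _).trans (natDegree_X_sub_C_le _)

lemma natDegree_piece_le (t : ℤ → ℝ) (j : ℤ) (p : ℕ) (i : ℤ) :
    (piece t j p i).natDegree ≤ p := by
  induction p generalizing i with
  | zero => unfold piece; split_ifs <;> simp
  | succ p ih =>
    rw [piece, add_comm p 1]
    refine natDegree_add_le_of_degree_le ?_ ?_
    · exact natDegree_mul_le_of_le (natDegree_betaPoly_le ..) (ih _)
    · refine natDegree_mul_le_of_le ?_ (ih _)
      exact (natDegree_sub_le _ _).trans (by simp [natDegree_betaPoly_le])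

lemma degree_piece_le (t : ℤ → ℝ) (j : ℤ) (p : ℕ) (i : ℤ) : (piece t j p i).degree ≤ p :=
  natDegree_le_iff_degree_le.mp (natDegree_piece_le t j p i)

lemma piece_eq_zero (t : ℤ → ℝ) (j : ℤ) (p : ℕ) (i : ℤ) (h : i ∉ Finset.Icc (j - p) j) :
    piece t j p i = 0 := by
  induction p generalizing i with
  | zero =>
    rw [piece, if_neg]
    rintro rfl
    simp at h
  | succ p ih =>
    rw [Finset.mem_Icc] at h
    push_cast at h
    rw [piece, ih i (by rw [Finset.mem_Icc]; omega), ih (i + 1) (by rw [Finset.mem_Icc]; omega)]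
    simp

lemma eq_of_mem_Ico {t : ℤ → ℝ} (hmono : Monotone t) {i j : ℤ} {x : ℝ}
    (hi : x ∈ Ico (t (i - 1)) (t i)) (hj : x ∈ Ico (t (j - 1)) (t j)) : i = j := by
  rcases lt_trichotomy i j with h | h | h
  · exact absurd (hmono (show i ≤ j - 1 by omega)) (not_le.mpr (hj.1.trans_lt hi.2))
  · exact h
  · exact absurd (hmono (show j ≤ i - 1 by omega)) (not_le.mpr (hi.1.trans_lt hj.2))

lemma Bspline_eq_eval_piece {t : ℤ → ℝ} (hmono : Monotone t) {j : ℤ} {x : ℝ}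
    (hx : x ∈ Ico (t (j - 1)) (t j)) (p : ℕ) (i : ℤ) :
    Bspline t p i x = (piece t j p i).eval x := by
  induction p generalizing i with
  | zero =>
    rw [Bspline, piece]
    by_cases h : i = j
    · subst h; simp [hx]
    · rw [if_neg fun h' => h (eq_of_mem_Ico hmono h' hx), if_neg h, eval_zero]
  | succ p ih => simp [Bspline, piece, ih, eval_betaPoly]

lemma knotPoly_succ (t : ℤ → ℝ) (p : ℕ) (i : ℤ) :
    knotPoly t (p + 1) i = knotPoly t p i * (X - C (t (i + p))) := by
  simp [knotPoly, Finset.prod_range_succ]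

lemma knotPoly_succ' (t : ℤ → ℝ) (p : ℕ) (i : ℤ) :
    knotPoly t (p + 1) i = (X - C (t i)) * knotPoly t p (i + 1) := by
  simp [knotPoly, Finset.prod_range_succ', mul_comm, add_assoc, add_comm (1 : ℤ)]

/-- Marsden's identity on a single nonempty knot interval. -/
theorem marsden {t : ℤ → ℝ} (hmono : Monotone t) {j : ℤ} (hj : t (j - 1) < t j) (p : ℕ)
    (x y : ℝ) :
    ∑ i ∈ Finset.Icc (j - p) j, (knotPoly t p i).eval y * (piece t j p i).eval x
      = (y - x) ^ p := by
  induction p with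
  | zero => simp [piece, knotPoly]
  | succ p ih =>
    have key : ∀ i ∈ Finset.Icc (j - p) j,
        (knotPoly t (p + 1) i).eval y * (bsBeta t (i - 1) (p + 1) x * (piece t j p i).eval x)
          + (knotPoly t (p + 1) (i - 1)).eval y
            * ((1 - bsBeta t (i - 1) (p + 1) x) * (piece t j p i).eval x)
        = (y - x) * ((knotPoly t p i).eval y * (piece t j p i).eval x) := by
      intro i hi
      rw [Finset.mem_Icc] at hi
      have h1 : t (i - 1) ≤ t (j - 1) := hmono (by omega)
      have h2 : t j ≤ t (i + p) := hmono (by omega)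
      have h3 : t (i + p) - t (i - 1) ≠ 0 := by linarith
      have e : i - 1 + ((p + 1 : ℕ) : ℤ) = i + p := by push_cast; ring
      rw [knotPoly_succ, knotPoly_succ', sub_add_cancel, bsBeta, e, if_neg (by grind)]
      simp only [eval_mul, eval_sub, eval_X, eval_C]
      field_simp
      ring
    have e1 : Finset.Icc (j - ((p + 1 : ℕ) : ℤ)) j
        = insert (j - ((p + 1 : ℕ) : ℤ)) (Finset.Icc (j - p) j) := by
      ext i; simp only [Finset.mem_insert, Finset.mem_Icc]; push_cast; omega
    have e2 : Finset.Icc (j - ((p + 1 : ℕ) : ℤ)) j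
        = insert j ((Finset.Icc (j - p) j).image (fun i => i - 1)) := by
      ext i
      simp only [Finset.mem_insert, Finset.mem_Icc, Finset.mem_image]
      constructor
      · intro h
        by_cases h' : i = j
        · exact Or.inl h'
        · exact Or.inr ⟨i + 1, by push_cast at h; omega, by ring⟩
      · rintro (rfl | ⟨k, hk, rfl⟩) <;> push_cast <;> omega
    simp only [piece, eval_add, eval_mul, eval_sub, eval_one, eval_betaPoly, mul_add,
      Finset.sum_add_distrib]
    rw [pow_succ', ← ih, Finset.mul_sum, ← Finset.sum_congr rfl key, Finset.sum_add_distrib]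
    congr 1
    · rw [e1, Finset.sum_insert (by simp only [Finset.mem_Icc]; push_cast; omega),
        piece_eq_zero t j p (j - ((p + 1 : ℕ) : ℤ))
          (by simp only [Finset.mem_Icc]; push_cast; omega)]
      simp
    · rw [e2, Finset.sum_insert (by
          simp only [Finset.mem_image, Finset.mem_Icc]; rintro ⟨a, ha, ha'⟩; omega),
        piece_eq_zero t j p (j + 1) (by simp),
        Finset.sum_image (by intro a _ b _ h; simpa using h)]
      simp

/-- The functional on polynomials of degree at most `p` giving the coefficient of
`Bspline t p i`, in terms of Taylor coefficients at `s`. -/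
noncomputable def dualFunctional (t : ℤ → ℝ) (p : ℕ) (s : ℝ) (i : ℤ) : ℝ[X] →ₗ[ℝ] ℝ :=
  ∑ r ∈ Finset.range (p + 1),
    ((-1) ^ r * (taylor s (knotPoly t p i)).coeff (p - r) / (p.choose r : ℝ)) •
      (lcoeff ℝ r ∘ₗ taylor s)

lemma dualFunctional_apply (t : ℤ → ℝ) (p : ℕ) (s : ℝ) (i : ℤ) (P : ℝ[X]) :
    dualFunctional t p s i P = ∑ r ∈ Finset.range (p + 1),
      (-1) ^ r * (taylor s (knotPoly t p i)).coeff (p - r) / (p.choose r : ℝ)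
        * (taylor s P).coeff r := by
  simp [dualFunctional]

lemma coeff_taylor_eq_zero {P : ℝ[X]} {s : ℝ} {n r : ℕ} (h : (X - C s) ^ n ∣ P) (hr : r < n) :
    (taylor s P).coeff r = 0 := by
  obtain ⟨Q, rfl⟩ := h
  simp [taylor_mul, taylor_pow, coeff_X_pow_mul', hr]

lemma dualFunctional_eq_zero {t : ℤ → ℝ} {p : ℕ} {s : ℝ} {i : ℤ} {k : ℕ}
    (hk : (X - C s) ^ k ∣ knotPoly t p i) {P : ℝ[X]} (hP : (X - C s) ^ (p + 1 - k) ∣ P) :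
    dualFunctional t p s i P = 0 := by
  rw [dualFunctional_apply]
  refine Finset.sum_eq_zero fun r hr => ?_
  rw [Finset.mem_range] at hr
  by_cases h : r < p + 1 - k
  · rw [coeff_taylor_eq_zero hP h, mul_zero]
  · rw [coeff_taylor_eq_zero hk (by omega)]
    simp

lemma marsden_coeff {t : ℤ → ℝ} (hmono : Monotone t) {j : ℤ} (hj : t (j - 1) < t j) (p : ℕ)
    (s x : ℝ) {r : ℕ} (hr : r ≤ p) :
    ∑ i ∈ Finset.Icc (j - p) j,
      (-1) ^ r * (taylor s (knotPoly t p i)).coeff (p - r) / (p.choose r : ℝ)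
        * (piece t j p i).eval x = (x - s) ^ r := by
  have h : ∑ i ∈ Finset.Icc (j - p) j, taylor s (knotPoly t p i) * C ((piece t j p i).eval x)
      = (X + C (s - x)) ^ p := by
    refine Polynomial.funext fun z => ?_
    simp only [eval_finsetSum, eval_mul, eval_C, taylor_eval, eval_pow, eval_add, eval_X]
    rw [marsden hmono hj]
    ring
  have h' := congrArg (fun P : ℝ[X] => P.coeff (p - r)) h
  simp only [finsetSum_coeff, coeff_mul_C, coeff_X_add_C_pow, Nat.choose_symm hr,
    Nat.sub_sub_self hr] at h'
  have hc : (p.choose r : ℝ) ≠ 0 := by exact_mod_cast (Nat.choose_pos hr).ne'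
  calc _ = (-1) ^ r / (p.choose r : ℝ) * ∑ i ∈ Finset.Icc (j - p) j,
        (taylor s (knotPoly t p i)).coeff (p - r) * (piece t j p i).eval x := by
        rw [Finset.mul_sum]
        exact Finset.sum_congr rfl fun i _ => by ring
    _ = ((-1) * (s - x)) ^ r := by rw [h', mul_pow]; field_simp
    _ = (x - s) ^ r := by ring

theorem sum_dualFunctional_mul_piece {t : ℤ → ℝ} (hmono : Monotone t) {j : ℤ}
    (hj : t (j - 1) < t j) {p : ℕ} (s : ℝ) {P : ℝ[X]} (hP : P.degree ≤ p) :
    ∑ i ∈ Finset.Icc (j - p) j, dualFunctional t p s i P • piece t j p i = P := by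
  refine Polynomial.funext fun x => ?_
  simp only [eval_finsetSum, eval_smul, smul_eq_mul, dualFunctional_apply, Finset.sum_mul]
  rw [Finset.sum_comm]
  have h : ∀ r ∈ Finset.range (p + 1), ∑ i ∈ Finset.Icc (j - p) j,
      (-1) ^ r * (taylor s (knotPoly t p i)).coeff (p - r) / (p.choose r : ℝ)
        * (taylor s P).coeff r * (piece t j p i).eval x
      = (taylor s P).coeff r * (x - s) ^ r := by
    intro r hr
    rw [← marsden_coeff hmono hj p s x (Nat.lt_succ_iff.mp (Finset.mem_range.mp hr)),
      Finset.mul_sum]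
    exact Finset.sum_congr rfl fun i _ => by ring
  have hd : (taylor s P).natDegree < p + 1 := by
    rw [natDegree_taylor]
    exact Nat.lt_succ_of_le (natDegree_le_iff_degree_le.mpr hP)
  rw [Finset.sum_congr rfl h, ← eval_eq_sum_range' hd, taylor_eval]
  simp

/-- The B-spline pieces on a nonempty knot interval are linearly independent. -/
theorem linearIndependent_piece {t : ℤ → ℝ} (hmono : Monotone t) {j : ℤ}
    (hj : t (j - 1) < t j) (p : ℕ) :
    LinearIndependent ℝ (fun i : Finset.Icc (j - (p : ℤ)) j => piece t j p i) := by
  let v : Finset.Icc (j - (p : ℤ)) j → degreeLE ℝ p := fun i =>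
    ⟨piece t j p i, mem_degreeLE.mpr (degree_piece_le t j p i)⟩
  suffices h : LinearIndependent ℝ v from
    h.map' (degreeLE ℝ p).subtype (Submodule.ker_subtype _)
  refine linearIndependent_of_top_le_span_of_card_eq_finrank ?_ ?_
  · rintro ⟨P, hP⟩ -
    have : (⟨P, hP⟩ : degreeLE ℝ p) =
        ∑ i : Finset.Icc (j - (p : ℤ)) j, dualFunctional t p 0 i P • v i := by
      apply Subtype.ext
      rw [Submodule.coe_sum]
      simp only [Submodule.coe_smul, v]
      rw [Finset.sum_coe_sort (Finset.Icc (j - (p : ℤ)) j)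
        (fun i => dualFunctional t p 0 i P • piece t j p i),
        sum_dualFunctional_mul_piece hmono hj 0 (mem_degreeLE.mp hP)]
    rw [this]
    exact Submodule.sum_mem _ fun i _ =>
      Submodule.smul_mem _ _ (Submodule.subset_span (mem_range_self i))
  · have e : degreeLE ℝ p = degreeLT ℝ (p + 1) := by
      ext P
      rw [mem_degreeLE, mem_degreeLT, Nat.cast_add_one, degree_le_iff_coeff_zero,
        ← Nat.cast_add_one, degree_lt_iff_coeff_zero]
      simp
    rw [e, (degreeLTEquiv ℝ (p + 1)).finrank_eq]
    simp
    omega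

lemma dualFunctional_piece {t : ℤ → ℝ} (hmono : Monotone t) {j : ℤ} (hj : t (j - 1) < t j)
    {p : ℕ} (s : ℝ) {i' : ℤ} (hi' : i' ∈ Finset.Icc (j - p : ℤ) j) (i : ℤ) :
    dualFunctional t p s i' (piece t j p i) = if i' = i then 1 else 0 := by
  by_cases hi : i ∈ Finset.Icc (j - p : ℤ) j
  · have h := sum_dualFunctional_mul_piece hmono hj s (degree_piece_le t j p i)
    have h0 : ∑ k ∈ Finset.Icc (j - p : ℤ) j,
        (dualFunctional t p s k (piece t j p i) - if k = i then 1 else 0) • piece t j p k = 0 := by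
      simp only [sub_smul, Finset.sum_sub_distrib, h, ite_smul, one_smul, zero_smul,
        Finset.sum_ite_eq', if_pos hi, sub_self]
    rw [← Finset.sum_coe_sort] at h0
    exact sub_eq_zero.mp (Fintype.linearIndependent_iff.mp (linearIndependent_piece hmono hj p)
      (fun k => dualFunctional t p s k (piece t j p i) - if (k : ℤ) = i then 1 else 0) h0 ⟨i', hi'⟩)
  · rw [piece_eq_zero t j p i hi, map_zero, if_neg]
    rintro rfl
    exact hi hi'

lemma dualFunctional_eq {t : ℤ → ℝ} (hmono : Monotone t) {j : ℤ} (hj : t (j - 1) < t j)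
    {p : ℕ} (s s' : ℝ) {i : ℤ} (hi : i ∈ Finset.Icc (j - p : ℤ) j) {P : ℝ[X]}
    (hP : P.degree ≤ p) : dualFunctional t p s i P = dualFunctional t p s' i P := by
  conv_lhs => rw [← sum_dualFunctional_mul_piece hmono hj s' hP]
  simp [dualFunctional_piece hmono hj s hi, Finset.mem_Icc.mp hi]

/-- A B-spline ending at the right end point of a knot interval vanishes there to the expected
order. -/
lemma pow_dvd_piece {t : ℤ → ℝ} (hmono : Monotone t) {j : ℤ} (hj : t (j - 1) < t j) {p n : ℕ}
    {i : ℤ} (hn : i + n = j) (hi : t (i + p) ≤ t j) : (X - C (t j)) ^ n ∣ piece t j p i := by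
  induction p generalizing n i with
  | zero =>
    rw [piece]
    split_ifs with h
    · obtain rfl : n = 0 := by omega
      simp
    · exact dvd_zero _
  | succ p ih =>
    rcases n with _ | n
    · simp
    rw [piece]
    refine dvd_add (Dvd.dvd.mul_left (ih hn ((hmono ?_).trans hi)) _) ?_
    · push_cast; omega
    have h1 := ih (n := n) (i := i + 1) (by push_cast at hn; omega)
      (by convert hi using 2; push_cast; ring)
    by_cases hp : j ≤ i + ((p + 1 : ℕ) : ℤ)
    · have e : t (i + ((p + 1 : ℕ) : ℤ)) = t j := le_antisymm hi (hmono hp)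
      have hij : t i < t j := (hmono (by push_cast at hn; omega)).trans_lt hj
      rw [pow_succ']
      refine mul_dvd_mul ⟨-C (t j - t i)⁻¹, ?_⟩ h1
      have h2 : C (t j - t i)⁻¹ * (C (t j) - C (t i)) = 1 := by
        rw [← C_sub, ← C_mul, inv_mul_cancel₀ (sub_ne_zero.mpr hij.ne'), C_1]
      rw [betaPoly, e, if_neg hij.ne]
      linear_combination -h2
    · rw [piece_eq_zero t j p (i + 1) (by rw [Finset.mem_Icc]; push_cast at hp; omega), mul_zero]
      exact dvd_zero _

lemma pow_succ_dvd_of_derivative {D : ℝ[X]} {s : ℝ} {n : ℕ} (h0 : D.eval s = 0)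
    (h : (X - C s) ^ n ∣ derivative D) : (X - C s) ^ (n + 1) ∣ D := by
  by_cases hD : D = 0
  · simp [hD]
  have hD' : derivative D ≠ 0 := by
    intro h'
    have h1 := eq_C_of_derivative_eq_zero h'
    rw [h1, eval_C] at h0
    rw [h0, C_0] at h1
    exact hD h1
  have h1 := (le_rootMultiplicity_iff hD').mpr h
  rw [derivative_rootMultiplicity_of_root h0] at h1
  have h2 : 0 < D.rootMultiplicity s := (rootMultiplicity_pos hD).mpr h0
  exact (le_rootMultiplicity_iff hD).mp (by omega)

open Filter Topology

/-- The jump of a `C^n` function between two polynomial pieces vanishes to order `n + 1`. -/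
theorem pow_dvd_sub_of_contDiffAt {n : ℕ} {f : ℝ → ℝ} {s : ℝ} {P Q : ℝ[X]}
    (hf : ContDiffAt ℝ n f s) (hP : ∀ᶠ x in 𝓝[<] s, f x = P.eval x)
    (hQ : ∀ᶠ x in 𝓝[>] s, f x = Q.eval x) : (X - C s) ^ (n + 1) ∣ Q - P := by
  have hlim : ∀ {g : ℝ → ℝ} {R : ℝ[X]} {l : Set ℝ} [(𝓝[l] s).NeBot], ContinuousAt g s →
      (∀ᶠ x in 𝓝[l] s, g x = R.eval x) → R.eval s = g s := by
    intro g R l _ hg h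
    exact tendsto_nhds_unique ((R.continuous.continuousAt.tendsto.mono_left
      nhdsWithin_le_nhds).congr' (h.mono fun x hx => hx.symm))
      (hg.tendsto.mono_left nhdsWithin_le_nhds)
  have hd : ∀ {g : ℝ → ℝ} {R : ℝ[X]} {l : Set ℝ}, IsOpen l → (∀ᶠ x in 𝓝[l] s, g x = R.eval x) →
      ∀ᶠ x in 𝓝[l] s, deriv g x = (derivative R).eval x := by
    intro g R l hl h
    rw [eventually_nhdsWithin_iff] at h ⊢
    filter_upwards [h.eventually_nhds] with x hx hxl
    have : g =ᶠ[𝓝 x] fun y => R.eval y := by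
      filter_upwards [hx, hl.mem_nhds hxl] with y hy hyl using hy hyl
    rw [this.deriv_eq, Polynomial.deriv]
  induction n generalizing f P Q with
  | zero =>
    simp [dvd_iff_isRoot, hlim hf.continuousAt hP, hlim hf.continuousAt hQ]
  | succ n ih =>
    refine pow_succ_dvd_of_derivative ?_ ?_
    · rw [eval_sub, hlim hf.continuousAt hP, hlim hf.continuousAt hQ, sub_self]
    · rw [derivative_sub]
      have hf' : ContDiffAt ℝ n (deriv f) s :=
        (hf.fderiv_right (m := n) (by norm_cast)).clm_apply contDiffAt_const
      exact ih hf' (hd isOpen_Iio hP) (hd isOpen_Ioi hQ)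

/-- A polynomial vanishing to order `n + 1` at `s` and cut off to the left of `s` is `C^n`. -/
theorem contDiff_truncated {n : ℕ} {s : ℝ} {D : ℝ[X]} (h : (X - C s) ^ (n + 1) ∣ D) :
    ContDiff ℝ n (fun x => if s ≤ x then D.eval x else 0) := by
  have h0 : D.eval s = 0 := dvd_iff_isRoot.mp ((dvd_pow_self _ n.succ_ne_zero).trans h)
  have hc : ∀ {E : ℝ[X]}, E.eval s = 0 → Continuous (fun x => if s ≤ x then E.eval x else 0) := by
    intro E hE
    refine Continuous.if_le E.continuous continuous_const continuous_const continuous_id ?_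
    rintro x rfl
    exact hE
  induction n generalizing D with
  | zero => exact contDiff_zero.mpr (hc h0)
  | succ n ih =>
    have h' : (X - C s) ^ (n + 1) ∣ derivative D := by
      simpa using pow_sub_one_dvd_derivative_of_pow_dvd h
    have h0' : (derivative D).eval s = 0 :=
      dvd_iff_isRoot.mp ((dvd_pow_self _ n.succ_ne_zero).trans h')
    have hd : ∀ x, HasDerivAt (fun x => if s ≤ x then D.eval x else 0)
        (if s ≤ x then (derivative D).eval x else 0) x := by
      intro x
      rcases lt_trichotomy s x with hx | rfl | hx
      · rw [if_pos hx.le]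
        refine (D.hasDerivAt x).congr_of_eventuallyEq ?_
        filter_upwards [lt_mem_nhds hx] with y hy using if_pos hy.le
      · rw [if_pos le_rfl, h0', ← hasDerivWithinAt_univ, ← Iic_union_Ici (a := s)]
        refine HasDerivWithinAt.union ?_ ?_
        · refine (hasDerivWithinAt_const s _ (0 : ℝ)).congr ?_ (by simp [h0])
          intro y hy
          rcases (mem_Iic.mp hy).lt_or_eq with hy | rfl
          · exact if_neg hy.not_ge
          · simp [h0]
        · have := (D.hasDerivAt s).hasDerivWithinAt (s := Ici s)
          rw [h0'] at this
          exact this.congr (fun y hy => if_pos hy) (if_pos le_rfl)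
      · rw [if_neg hx.not_ge]
        refine (hasDerivAt_const x (0 : ℝ)).congr_of_eventuallyEq ?_
        filter_upwards [gt_mem_nhds hx] with y hy using if_neg hy.not_ge
    push_cast
    rw [contDiff_succ_iff_deriv]
    refine ⟨fun x => (hd x).differentiableAt, by simp, ?_⟩
    rw [funext fun x => (hd x).deriv]
    exact ih h' h0'

section Knots

variable {t : ℤ → ℝ}

lemma pow_dvd_knotPoly {j : ℤ} {k p : ℕ} (hmono : Monotone t) (hjk : t (j + k - 1) = t j)
    {i : ℤ} (hi : i ∈ Finset.Icc (j + k - p : ℤ) j) : (X - C (t j)) ^ k ∣ knotPoly t p i := by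
  rw [Finset.mem_Icc] at hi
  obtain ⟨d, hd⟩ := Int.le.dest hi.2
  have h : ∏ m ∈ Finset.Ico d (d + k), (X - C (t (i + m))) = (X - C (t j)) ^ k := by
    rw [Finset.prod_congr rfl (g := fun _ => X - C (t j)), Finset.prod_const]
    · simp
    · intro m hm
      rw [Finset.mem_Ico] at hm
      have h1 : t j ≤ t (i + m) := hmono (by omega)
      have h2 : t (i + m) ≤ t (j + k - 1) := hmono (by omega)
      rw [le_antisymm (h2.trans hjk.le) h1]
  rw [← h, knotPoly]
  refine Finset.prod_dvd_prod_of_subset _ _ _ fun m hm => ?_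
  rw [Finset.mem_Ico] at hm
  rw [Finset.mem_range]
  omega

/-- At a knot of multiplicity `k`, the pieces of a B-spline on the two sides agree to order
`p - k`. -/
theorem pow_dvd_piece_sub_piece (hmono : Monotone t) {j : ℤ} {k : ℕ}
    (hj : t (j - 1) < t j) (hjk : t (j + k - 1) = t j) (hk : t (j + k - 1) < t (j + k)) (p : ℕ)
    (i : ℤ) : (X - C (t j)) ^ (p + 1 - k) ∣ piece t (j + k) p i - piece t j p i := by
  have hdeg : (piece t (j + k) p i - piece t j p i).degree ≤ p :=
    (degree_sub_le _ _).trans (max_le (degree_piece_le ..) (degree_piece_le ..))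
  rw [← sum_dualFunctional_mul_piece hmono hj 0 hdeg]
  refine Finset.dvd_sum fun i' hi' => ?_
  rw [Finset.mem_Icc] at hi'
  by_cases h : j + k - p ≤ i'
  · rw [map_sub, dualFunctional_piece hmono hk 0 (by rw [Finset.mem_Icc]; omega),
      dualFunctional_piece hmono hj 0 (Finset.mem_Icc.mpr hi'), sub_self, zero_smul]
    exact dvd_zero _
  · obtain ⟨n, hn⟩ := Int.le.dest hi'.2
    rw [smul_eq_C_mul]
    refine Dvd.dvd.mul_left ((pow_dvd_pow _ ?_).trans (pow_dvd_piece hmono hj hn ?_)) _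
    · omega
    · exact (hmono (by omega)).trans hjk.le

lemma exists_mem_Ico (htop : Tendsto t atTop atTop) (hbot : Tendsto t atBot atBot) (x : ℝ) :
    ∃ j, x ∈ Ico (t (j - 1)) (t j) := by
  obtain ⟨n, hn⟩ := (hbot.eventually (eventually_le_atBot x)).exists_forall_of_atBot
  obtain ⟨j, hj, hj'⟩ := Int.exists_least_of_bdd (P := fun j => x < t j)
    ⟨n, fun z hz => le_of_not_gt fun h => (hn z h.le).not_gt hz⟩
    (htop.eventually (eventually_gt_atTop x)).exists
  exact ⟨j, not_lt.mp fun h => absurd (hj' _ h) (by omega), hj⟩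

lemma exists_mem_Ioc (htop : Tendsto t atTop atTop) (hbot : Tendsto t atBot atBot) (x : ℝ) :
    ∃ j, x ∈ Ioc (t (j - 1)) (t j) := by
  obtain ⟨n, hn⟩ := (hbot.eventually (eventually_lt_atBot x)).exists_forall_of_atBot
  obtain ⟨j, hj, hj'⟩ := Int.exists_least_of_bdd (P := fun j => x ≤ t j)
    ⟨n, fun z hz => le_of_not_gt fun h => (hn z h.le).not_ge hz⟩
    (htop.eventually (eventually_ge_atTop x)).exists
  exact ⟨j, not_le.mp fun h => absurd (hj' _ h) (by omega), hj⟩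

/-- The knots equal to a given knot are consecutive. -/
lemma exists_knot_block (hmono : Monotone t) (htop : Tendsto t atTop atTop)
    (hbot : Tendsto t atBot atBot) (i : ℤ) : ∃ (j : ℤ) (k : ℕ),
      t j = t i ∧ t (j - 1) < t j ∧ t (j + k - 1) = t j ∧ t (j + k - 1) < t (j + k) := by
  obtain ⟨j, hj⟩ := exists_mem_Ioc htop hbot (t i)
  obtain ⟨j', hj'⟩ := exists_mem_Ico htop hbot (t i)
  have h1 : j ≤ i := by
    by_contra h
    exact (hmono (show i ≤ j - 1 by omega)).not_gt hj.1
  have h2 : i < j' := hmono.reflect_lt hj'.2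
  obtain ⟨k, rfl⟩ := Int.le.dest (h1.trans h2.le)
  have h3 : t j = t i := le_antisymm (hmono h1) hj.2
  have h4 : t (j + k - 1) = t i := le_antisymm hj'.1 (hmono (by omega))
  exact ⟨j, k, h3, h3 ▸ hj.1, h4.trans h3.symm, h4 ▸ hj'.2⟩

lemma ncard_knot_block (hmono : Monotone t) {j : ℤ} {k : ℕ}
    (hj : t (j - 1) < t j) (hjk : t (j + k - 1) = t j) (hk : t (j + k - 1) < t (j + k)) :
    {i : ℤ | t i = t j}.ncard = k := by
  have h : {i : ℤ | t i = t j} = (Finset.Icc j (j + k - 1) : Finset ℤ) := by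
    ext i
    simp only [mem_ofPred_eq, Finset.coe_Icc, mem_Icc]
    constructor
    · intro hi
      rw [← hi] at hj
      have h1 := hmono.reflect_lt hj
      rw [hjk, ← hi] at hk
      have h2 := hmono.reflect_lt hk
      omega
    · rintro ⟨h1, h2⟩
      exact le_antisymm ((hmono h2).trans hjk.le) (hmono h1)
  rw [h, Set.ncard_coe_finset]
  simp

end Knots

section Spanning

variable {t : ℤ → ℝ} {a b : ℝ} {p : ℕ} {P : ℤ → ℝ[X]}

/-- Coefficients of a piecewise polynomial with the prescribed jumps do not depend on the knot
interval from which they are computed. -/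
lemma dualFunctional_eq_of_jump (hmono : Monotone t) (hdeg : ∀ j, (P j).degree ≤ p)
    (hjump : ∀ (j : ℤ) (k : ℕ), t (j - 1) < t j → t (j + k - 1) = t j →
      t (j + k - 1) < t (j + k) → t j ∈ Ioo a b → (X - C (t j)) ^ (p + 1 - k) ∣ P (j + k) - P j)
    {i : ℤ} (m : ℕ) {j : ℤ} (hj : t (j - 1) < t j) (hja : a < t j)
    (hm : t (j + m - 1) < t (j + m)) (hmb : t (j + m - 1) < b)
    (hi : i ∈ Finset.Icc (j + m - p : ℤ) j) :
    dualFunctional t p 0 i (P j) = dualFunctional t p 0 i (P (j + m)) := by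
  induction m using Nat.strong_induction_on generalizing j with
  | _ m ih =>
  rcases Nat.eq_zero_or_pos m with rfl | hm0
  · simp
  rw [Finset.mem_Icc] at hi
  have hjm : t j ≤ t (j + m - 1) := hmono (by omega)
  obtain ⟨j', hj', hleast⟩ := Int.exists_least_of_bdd (P := fun n => t j < t n)
    ⟨j, fun z hz => (hmono.reflect_lt hz).le⟩ ⟨j + m, hjm.trans_lt hm⟩
  have h1 : j < j' := hmono.reflect_lt hj'
  have h2 : j' ≤ j + m := hleast _ (hjm.trans_lt hm)
  obtain ⟨k, rfl⟩ := Int.le.dest h1.le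
  have h3 : t (j + k - 1) = t j := by
    refine le_antisymm (not_lt.mp fun h => ?_) (hmono (by omega))
    have := hleast _ h
    omega
  obtain ⟨n, rfl⟩ : ∃ n, m = k + n := Nat.exists_eq_add_of_le (by omega)
  have e : j + ((k + n : ℕ) : ℤ) = j + k + n := by push_cast; ring
  rw [e] at hm hmb hi hjm ⊢
  have h4 : t (j + k - 1) < t (j + k) := h3 ▸ hj'
  have hQ : (P (j + k) - P j).degree ≤ p :=
    (degree_sub_le _ _).trans (max_le (hdeg _) (hdeg _))
  have h5 : dualFunctional t p 0 i (P (j + k) - P j) = 0 := by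
    rw [dualFunctional_eq hmono hj 0 (t j) (by rw [Finset.mem_Icc]; omega) hQ]
    exact dualFunctional_eq_zero
      (pow_dvd_knotPoly hmono h3 (by rw [Finset.mem_Icc]; omega))
      (hjump j k hj h3 h4 ⟨hja, hjm.trans_lt hmb⟩)
  rw [map_sub, sub_eq_zero] at h5
  rw [← h5]
  exact ih n (by omega) h4 (hja.trans hj') hm hmb (by rw [Finset.mem_Icc]; omega)

/-- A piecewise polynomial with the prescribed jumps is a combination of B-splines. -/
theorem exists_eq_sum_Bspline (hmono : Monotone t)
    (htop : Tendsto t atTop atTop) (hbot : Tendsto t atBot atBot)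
    (hdeg : ∀ j, (P j).degree ≤ p)
    (hjump : ∀ (j : ℤ) (k : ℕ), t (j - 1) < t j → t (j + k - 1) = t j →
      t (j + k - 1) < t (j + k) → t j ∈ Ioo a b → (X - C (t j)) ^ (p + 1 - k) ∣ P (j + k) - P j) :
    ∃ (s : Finset ℤ) (c : ℤ → ℝ), ∀ (j : ℤ), ∀ x ∈ Ico (t (j - 1)) (t j) ∩ Ico a b,
      (P j).eval x = ∑ i ∈ s, c i * Bspline t p i x := by
  have hc : ∀ i : ℤ, ∃ c : ℝ, ∀ j, t (j - 1) < t j → t (j - 1) < b → a < t j →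
      i ∈ Finset.Icc (j - p : ℤ) j → dualFunctional t p 0 i (P j) = c := by
    intro i
    by_cases h : ∃ j, t (j - 1) < t j ∧ t (j - 1) < b ∧ a < t j ∧ i ∈ Finset.Icc (j - p : ℤ) j
    · obtain ⟨j, hj, hjb, hja, hij⟩ := h
      refine ⟨dualFunctional t p 0 i (P j), fun j' hj' hjb' hja' hij' => ?_⟩
      rw [Finset.mem_Icc] at hij hij'
      rcases le_total j j' with h | h <;> obtain ⟨m, rfl⟩ := Int.le.dest h
      · exact (dualFunctional_eq_of_jump hmono hdeg hjump m hj hja hj' hjb'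
          (by rw [Finset.mem_Icc]; omega)).symm
      · exact dualFunctional_eq_of_jump hmono hdeg hjump m hj' hja' hj hjb
          (by rw [Finset.mem_Icc]; omega)
    · exact ⟨0, fun j h1 h2 h3 h4 => absurd ⟨j, h1, h2, h3, h4⟩ h⟩
  choose c hc using hc
  obtain ⟨m, hm⟩ := (hbot.eventually (eventually_le_atBot a)).exists
  obtain ⟨M, hM⟩ := (htop.eventually (eventually_ge_atTop b)).exists
  refine ⟨Finset.Icc (m - p) M, c, fun j x hx => ?_⟩
  have hj : t (j - 1) < t j := hx.1.1.trans_lt hx.1.2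
  have hjb : t (j - 1) < b := hx.1.1.trans_lt hx.2.2
  have hja : a < t j := hx.2.1.trans_lt hx.1.2
  have h1 : m < j := hmono.reflect_lt (hm.trans_lt hja)
  have h2 : j - 1 < M := hmono.reflect_lt (hjb.trans_le hM)
  conv_lhs => rw [← sum_dualFunctional_mul_piece hmono hj 0 (hdeg j), eval_finsetSum]
  rw [← Finset.sum_subset (s₁ := Finset.Icc (j - p : ℤ) j)
    (s₂ := Finset.Icc (m - p : ℤ) M) (Finset.Icc_subset_Icc (by omega) (by omega))]
  · refine Finset.sum_congr rfl fun i hi => ?_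
    rw [hc i j hj hjb hja hi, Bspline_eq_eval_piece hmono hx.1, eval_smul, smul_eq_mul]
  · intro i _ hi
    rw [Bspline_eq_eval_piece hmono hx.1, piece_eq_zero t j p i hi, eval_zero, mul_zero]

end Spanning

section LocalPieces

variable {t : ℤ → ℝ} {a b : ℝ} {f : ℝ → ℝ} {j : ℤ} {P : ℝ[X]}

lemma eventually_nhdsLT_eq_eval (hP : ∀ x ∈ Ico (t (j - 1)) (t j) ∩ Ico a b, f x = P.eval x)
    {s : ℝ} (hs : s ∈ Ioo a b) (hsj : s ∈ Ioc (t (j - 1)) (t j)) :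
    ∀ᶠ x in 𝓝[<] s, f x = P.eval x := by
  filter_upwards [Ioo_mem_nhdsLT hs.1, Ioo_mem_nhdsLT hsj.1] with x h1 h2
  exact hP x ⟨⟨h2.1.le, h2.2.trans_le hsj.2⟩, h1.1.le, h1.2.trans hs.2⟩

lemma eventually_nhdsGE_eq_eval (hP : ∀ x ∈ Ico (t (j - 1)) (t j) ∩ Ico a b, f x = P.eval x)
    {s : ℝ} (hs : s ∈ Ico a b) (hsj : s ∈ Ico (t (j - 1)) (t j)) :
    ∀ᶠ x in 𝓝[≥] s, f x = P.eval x := by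
  filter_upwards [Ico_mem_nhdsGE hs.2, Ico_mem_nhdsGE hsj.2] with x h1 h2
  exact hP x ⟨⟨hsj.1.trans h2.1, h2.2⟩, hs.1.trans h1.1, h1.2⟩

end LocalPieces

/-- A function agreeing with two polynomials on the two sides of `s` is `C^n` at `s` if their
difference vanishes to order `n + 1`. -/
theorem contDiffAt_of_pow_dvd_sub {n : ℕ} {f : ℝ → ℝ} {s : ℝ} {P Q : ℝ[X]}
    (hP : ∀ᶠ x in 𝓝[<] s, f x = P.eval x) (hQ : ∀ᶠ x in 𝓝[≥] s, f x = Q.eval x)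
    (h : (X - C s) ^ (n + 1) ∣ Q - P) : ContDiffAt ℝ n f s := by
  have h1 : ContDiff ℝ n (fun x => P.eval x + if s ≤ x then (Q - P).eval x else 0) :=
    (P.contDiff_aeval (𝕜 := ℝ) n).add (contDiff_truncated h)
  refine h1.contDiffAt.congr_of_eventuallyEq ?_
  rw [eventually_nhdsWithin_iff] at hP hQ
  filter_upwards [hP, hQ] with x h1 h2
  split_ifs with hx
  · rw [h2 hx, eval_sub]; ring
  · rw [h1 (not_le.mp hx), add_zero]

theorem linearIndependent_indicator_Bspline {t : ℤ → ℝ} (hmono : Monotone t)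
    (htop : Tendsto t atTop atTop) (hbot : Tendsto t atBot atBot) (a b : ℝ) (p : ℕ) :
    LinearIndependent ℝ (fun i : {i : ℤ // (Ico a b).indicator (Bspline t p i) ≠ 0} =>
      (Ico a b).indicator (Bspline t p i)) := by
  rw [linearIndependent_iff']
  rintro s c hc ⟨i, hi⟩ his
  obtain ⟨x, hx⟩ := Function.ne_iff.mp hi
  have hxab : x ∈ Ico a b := mem_of_indicator_ne_zero hx
  obtain ⟨j, hj⟩ := exists_mem_Ico htop hbot x
  rw [indicator_of_mem hxab, Bspline_eq_eval_piece hmono hj] at hx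
  have hij : i ∈ Finset.Icc (j - p : ℤ) j := by
    by_contra h
    simp [piece_eq_zero t j p i h] at hx
  have h0 : ∑ i ∈ s, c i • piece t j p i = 0 := by
    refine eq_zero_of_infinite_isRoot _ ((Ico_infinite (lt_min hxab.2 hj.2)).mono ?_)
    intro y hy
    have hyj : y ∈ Ico (t (j - 1)) (t j) := ⟨hj.1.trans hy.1, hy.2.trans_le (min_le_right _ _)⟩
    have hyab : y ∈ Ico a b := ⟨hxab.1.trans hy.1, hy.2.trans_le (min_le_left _ _)⟩
    have := congrFun hc y
    simpa [IsRoot, eval_finsetSum, Finset.sum_apply, indicator_of_mem hyab,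
      Bspline_eq_eval_piece hmono hyj] using this
  have h1 := congrArg (dualFunctional t p 0 i) h0
  simp only [map_sum, map_smul, map_zero,
    dualFunctional_piece hmono (hj.1.trans_lt hj.2) 0 hij, smul_eq_mul, mul_ite, mul_one,
    mul_zero] at h1
  rw [Finset.sum_eq_single ⟨i, hi⟩] at h1
  · simpa using h1
  · rintro ⟨i', hi'⟩ - hne
    exact if_neg fun h => hne (Subtype.ext h.symm)
  · exact fun h => absurd his h

end BSplineBasis

/-- Theorem 4.1 (Curry–Schoenberg): the nonzero restrictions of the B-splines to
`[a,b)` (realized as functions on `ℝ` extended by zero) form a basis of the space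
of right-continuous piecewise polynomials of degree `≤ p` on `[a,b)` which are
`p - k` times continuously differentiable at each interior knot of multiplicity
`k` with `k ≤ p` (also realized as functions on `ℝ` vanishing outside `[a,b)`). -/
theorem curry_schoenberg_basis
    (a b : ℝ) (hab : a < b) (p : ℕ) (t : ℤ → ℝ) (hmono : Monotone t)
    (htop : Filter.Tendsto t Filter.atTop Filter.atTop)
    (hbot : Filter.Tendsto t Filter.atBot Filter.atBot) :
    LinearIndependent ℝ
      (fun v : {g : ℝ → ℝ //
          (∃ i : ℤ, g = (Ico a b).indicator (Bspline t p i)) ∧ g ≠ 0} =>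
        (v : ℝ → ℝ)) ∧
    (Submodule.span ℝ
        {g : ℝ → ℝ | (∃ i : ℤ, g = (Ico a b).indicator (Bspline t p i)) ∧ g ≠ 0}
      : Set (ℝ → ℝ)) =
      {f : ℝ → ℝ |
        (∀ x ∉ Ico a b, f x = 0) ∧
        (∀ x ∈ Ico a b, Filter.Tendsto f (nhdsWithin x (Ico x b)) (nhds (f x))) ∧
        (∀ i : ℤ, ∃ P : Polynomial ℝ, P.degree ≤ (p : ℕ) ∧
          ∀ x ∈ Ico (t (i - 1)) (t i) ∩ Ico a b, f x = P.eval x) ∧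
        (∀ x ∈ Ioo a b, (∃ i : ℤ, t i = x) →
          ∀ k : ℕ, {i : ℤ | t i = x}.ncard = k → k ≤ p →
            ContDiffAt ℝ (p - k : ℕ) f x)} := by
  have hknot := BSplineBasis.exists_mem_Ico htop hbot
  refine ⟨?_, Subset.antisymm ?_ ?_⟩
  · choose idx hidx using fun v : {g : ℝ → ℝ //
      (∃ i : ℤ, g = (Ico a b).indicator (Bspline t p i)) ∧ g ≠ 0} => v.2.1
    have h := (BSplineBasis.linearIndependent_indicator_Bspline hmono htop hbot a b p).comp
      (fun v => ⟨idx v, hidx v ▸ v.2.2⟩) (by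
        intro v w hvw
        rw [Subtype.mk.injEq] at hvw
        exact Subtype.ext ((hidx v).trans (hvw ▸ (hidx w).symm)))
    convert h using 2 with v
    exact hidx v
  · intro f hf
    induction hf using Submodule.span_induction with
    | zero =>
      exact ⟨fun _ _ => rfl, fun _ _ => tendsto_const_nhds, fun _ => ⟨0, by simp, by simp⟩,
        fun _ _ _ _ _ _ => contDiffAt_const⟩
    | add f g _ _ hf hg =>
      obtain ⟨hf1, hf2, hf3, hf4⟩ := hf
      obtain ⟨hg1, hg2, hg3, hg4⟩ := hg
      refine ⟨fun x hx => ?_, fun x hx => (hf2 x hx).add (hg2 x hx), fun i => ?_,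
        fun x hx hi k hk hkp => (hf4 x hx hi k hk hkp).add (hg4 x hx hi k hk hkp)⟩
      · simp [hf1 x hx, hg1 x hx]
      · obtain ⟨P, hP, hfP⟩ := hf3 i
        obtain ⟨Q, hQ, hgQ⟩ := hg3 i
        refine ⟨P + Q, (Polynomial.degree_add_le _ _).trans (max_le hP hQ), fun x hx => ?_⟩
        rw [Pi.add_apply, hfP x hx, hgQ x hx, Polynomial.eval_add]
    | smul c f _ hf =>
      obtain ⟨hf1, hf2, hf3, hf4⟩ := hf
      refine ⟨fun x hx => ?_, fun x hx => (hf2 x hx).const_smul c, fun i => ?_,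
        fun x hx hi k hk hkp => (hf4 x hx hi k hk hkp).const_smul c⟩
      · simp [hf1 x hx]
      · obtain ⟨P, hP, hfP⟩ := hf3 i
        refine ⟨c • P, (Polynomial.degree_smul_le _ _).trans hP, fun x hx => ?_⟩
        rw [Pi.smul_apply, hfP x hx, Polynomial.eval_smul]
    | mem f hf =>
      obtain ⟨⟨i, rfl⟩, -⟩ := hf
      have hpiece : ∀ j, ∀ x ∈ Ico (t (j - 1)) (t j) ∩ Ico a b,
          (Ico a b).indicator (Bspline t p i) x = (BSplineBasis.piece t j p i).eval x := by
        intro j x hx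
        rw [indicator_of_mem hx.2, BSplineBasis.Bspline_eq_eval_piece hmono hx.1]
      refine ⟨fun x hx => indicator_of_notMem hx _, fun x hx => ?_,
        fun j => ⟨_, BSplineBasis.degree_piece_le t j p i, hpiece j⟩, ?_⟩
      · obtain ⟨j, hj⟩ := hknot x
        rw [hpiece j x ⟨hj, hx⟩]
        refine Filter.Tendsto.congr' ?_ (((BSplineBasis.piece t j p i).continuous.tendsto x).mono_left
          nhdsWithin_le_nhds)
        exact ((BSplineBasis.eventually_nhdsGE_eq_eval (hpiece j) hx hj).filter_mono
          (nhdsWithin_mono x fun y hy => hy.1)).mono fun y hy => hy.symm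
      · rintro x hx ⟨i₀, rfl⟩ k hk hkp
        obtain ⟨j, m, hj, hj1, hjm, hm⟩ := BSplineBasis.exists_knot_block hmono htop hbot i₀
        rw [← hj] at hx hk ⊢
        obtain rfl : m = k := (BSplineBasis.ncard_knot_block hmono hj1 hjm hm).symm.trans hk
        refine BSplineBasis.contDiffAt_of_pow_dvd_sub
          (BSplineBasis.eventually_nhdsLT_eq_eval (hpiece j) hx ⟨hj1, le_rfl⟩)
          (BSplineBasis.eventually_nhdsGE_eq_eval (hpiece (j + m)) ⟨hx.1.le, hx.2⟩
            ⟨hjm.le, hjm ▸ hm⟩) ?_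
        rw [← Nat.sub_add_comm hkp]
        exact BSplineBasis.pow_dvd_piece_sub_piece hmono hj1 hjm hm p i
  · rintro f ⟨hf0, -, hfP, hfC⟩
    choose P hdeg hP using hfP
    obtain ⟨s, c, hsum⟩ := BSplineBasis.exists_eq_sum_Bspline (a := a) (b := b) hmono htop hbot
      hdeg (by
        intro j k hj hjk hk hs
        by_cases hkp : k ≤ p
        · rw [Nat.sub_add_comm hkp]
          refine BSplineBasis.pow_dvd_sub_of_contDiffAt
            (hfC (t j) hs ⟨j, rfl⟩ k (BSplineBasis.ncard_knot_block hmono hj hjk hk) hkp)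
            (BSplineBasis.eventually_nhdsLT_eq_eval (hP j) hs ⟨hj, le_rfl⟩)
            ((BSplineBasis.eventually_nhdsGE_eq_eval (hP (j + k)) ⟨hs.1.le, hs.2⟩
              ⟨hjk.le, hjk ▸ hk⟩).filter_mono (nhdsWithin_mono _ Ioi_subset_Ici_self))
        · rw [Nat.sub_eq_zero_of_le (by omega), pow_zero]
          exact one_dvd _)
    have hf : f = ∑ i ∈ s, c i • (Ico a b).indicator (Bspline t p i) := by
      ext x
      by_cases hx : x ∈ Ico a b
      · obtain ⟨j, hj⟩ := hknot x
        simp [hP j x ⟨hj, hx⟩, hsum j x ⟨hj, hx⟩, indicator_of_mem hx]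
      · simp [hf0 x hx, indicator_of_notMem hx]
    rw [hf]
    refine Submodule.sum_mem _ fun i _ => Submodule.smul_mem _ _ ?_
    by_cases h : (Ico a b).indicator (Bspline t p i) = 0
    · rw [h]
      exact Submodule.zero_mem _
    · exact Submodule.subset_span ⟨⟨i, rfl⟩, h⟩
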